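/- arXiv:2302.03119 — 3 statements merged into one kernel-verified Lean document; each statement's English description precedes it below -/
import Mathlib

section
/- Define J : n_{−1} → n_{−1} on the degree −1 stratum of n_{E_II} by J(X_{8+i}) = X_{16+i} and J(X_{16+i}) = −X_{8+i} for i = 1,…,8. Then the set of linear endomorphisms T of n_{−1} that commute with the restriction to n_{−1} of every strata-preserving derivation A of n_{E_II} is exactly { α·id + β·J : α, β ∈ R }; in particular J² = −id, J commutes with every such restriction, and the only elements T of this commutant satisfying T² = −id are T = J and T = −J. Thus the 2-step nilpotent Lie algebra n_{E_II} canonically determines a complex structure on n_{−1}, unique up to sign. -/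
noncomputable section
open ComplexConjugate

/-- Points of `ℝ²⁴`, with coordinates `u^i = p (i-1)`, `x^i = p (7+i)`, `y^i = p (15+i)`
for `i = 1, …, 8`. -/
abbrev Pt : Type := Fin 24 → ℝ
/-- The bracket of the 24-dimensional 2-step nilpotent Lie algebra `n_{E_II}`, in the
basis `X_1, …, X_24` (indexed here by `0, …, 23`): for each term `ε·λ^B∧λ^D` in the E_II
structure equations one has `[X_B, X_D] = -ε·X_A`, and `X_1, …, X_8` are central. -/
def br (v w : Pt) : Pt := fun k =>
  if h : (k : ℕ) < 8 then
    (![-((v 8 * w 19 - v 19 * w 8) + (v 9 * w 18 - v 18 * w 9)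
        + (v 10 * w 17 - v 17 * w 10) + (v 11 * w 16 - v 16 * w 11)),
       -((v 8 * w 21 - v 21 * w 8) + (v 9 * w 20 - v 20 * w 9)
        + (v 12 * w 17 - v 17 * w 12) + (v 13 * w 16 - v 16 * w 13)),
       -((v 8 * w 14 - v 14 * w 8) - (v 10 * w 12 - v 12 * w 10)
        + (v 16 * w 22 - v 22 * w 16) - (v 18 * w 20 - v 20 * w 18)),
       -((v 8 * w 15 - v 15 * w 8) + (v 9 * w 14 - v 14 * w 9)
        + (v 10 * w 13 - v 13 * w 10) + (v 11 * w 12 - v 12 * w 11)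
        + (v 16 * w 23 - v 23 * w 16) + (v 17 * w 22 - v 22 * w 17)
        + (v 18 * w 21 - v 21 * w 18) + (v 19 * w 20 - v 20 * w 19)),
       -(-(v 8 * w 23 - v 23 * w 8) + (v 9 * w 22 - v 22 * w 9)
        + (v 10 * w 21 - v 21 * w 10) - (v 11 * w 20 - v 20 * w 11)
        - (v 12 * w 19 - v 19 * w 12) + (v 13 * w 18 - v 18 * w 13)
        + (v 14 * w 17 - v 17 * w 14) - (v 15 * w 16 - v 16 * w 15)),
       -((v 9 * w 15 - v 15 * w 9) - (v 11 * w 13 - v 13 * w 11)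
        + (v 17 * w 23 - v 23 * w 17) - (v 19 * w 21 - v 21 * w 19)),
       -((v 10 * w 23 - v 23 * w 10) + (v 11 * w 22 - v 22 * w 11)
        + (v 14 * w 19 - v 19 * w 14) + (v 15 * w 18 - v 18 * w 15)),
       -((v 12 * w 23 - v 23 * w 12) + (v 13 * w 22 - v 22 * w 13)
        + (v 14 * w 21 - v 21 * w 14) + (v 15 * w 20 - v 20 * w 15))] : Fin 8 → ℝ) ⟨k, h⟩
  else 0
/-- The stratum `n_{-2} = span (X_1, …, X_8)`. -/
def Nm2 : Submodule ℝ Pt where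
  carrier := {v | ∀ k : Fin 24, 8 ≤ (k : ℕ) → v k = 0}
  add_mem' := by
    intro a b ha hb
    simp only [Set.mem_setOf_eq] at ha hb ⊢
    intro k hk
    simp [Pi.add_apply, ha k hk, hb k hk]
  zero_mem' := by intro k _; rfl
  smul_mem' := by
    intro c v hv
    simp only [Set.mem_setOf_eq] at hv ⊢
    intro k hk
    simp [Pi.smul_apply, hv k hk]

/-- The stratum `n_{-1} = span (X_9, …, X_24)`. -/
def Nm1 : Submodule ℝ Pt where
  carrier := {v | ∀ k : Fin 24, (k : ℕ) < 8 → v k = 0}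
  add_mem' := by
    intro a b ha hb
    simp only [Set.mem_setOf_eq] at ha hb ⊢
    intro k hk
    simp [Pi.add_apply, ha k hk, hb k hk]
  zero_mem' := by intro k _; rfl
  smul_mem' := by
    intro c v hv
    simp only [Set.mem_setOf_eq] at hv ⊢
    intro k hk
    simp [Pi.smul_apply, hv k hk]
/-- A strata-preserving derivation: a linear endomorphism `A` with `A (n_{-1}) ⊆ n_{-1}`,
`A (n_{-2}) ⊆ n_{-2}`, and `A [v, w] = [A v, w] + [v, A w]`. -/
def IsSPDer (A : Module.End ℝ Pt) : Prop :=
  (∀ v ∈ Nm1, A v ∈ Nm1) ∧ (∀ v ∈ Nm2, A v ∈ Nm2) ∧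
    ∀ v w : Pt, A (br v w) = br (A v) w + br v (A w)
/-- The canonical complex structure on the stratum `n_{-1}`:
`J X_{8+i} = X_{16+i}` and `J X_{16+i} = -X_{8+i}` for `i = 1, …, 8`
(extended by `0` on `n_{-2}`). -/
def Jfun (v : Pt) : Pt := fun k =>
  if (k : ℕ) < 8 then 0 else if (k : ℕ) < 16 then -v (k + 8) else v (k - 8)

/-- `Jfun` as a linear endomorphism of `ℝ²⁴`. -/
def Jlin : Pt →ₗ[ℝ] Pt where
  toFun := Jfun
  map_add' := by
    intro a b; funext k
    simp only [Jfun, Pi.add_apply]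
    split_ifs <;> ring
  map_smul' := by
    intro c v; funext k
    simp only [Jfun, Pi.smul_apply, RingHom.id_apply, smul_eq_mul]
    split_ifs <;> ring

lemma Jlin_mem_Nm1 : ∀ v ∈ Nm1, Jlin v ∈ Nm1 := by
  intro v _
  show ∀ k : Fin 24, (k : ℕ) < 8 → Jlin v k = 0
  intro k hk
  show Jfun v k = 0
  simp [Jfun, hk]

/-- `J` as a linear endomorphism of the stratum `n_{-1}`. -/
def JN1 : Module.End ℝ ↥Nm1 := Jlin.restrict Jlin_mem_Nm1

/-- The diagonal derivation scaling `X_{8+i}` and `X_{16+i}` by `i - 1`, for `i = 1, …, 8`. -/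
def weightDer : Module.End ℝ Pt where
  toFun v k := (![3, 5, 6, 7, 7, 8, 9, 11, 0, 1, 2, 3, 4, 5, 6, 7,
    0, 1, 2, 3, 4, 5, 6, 7] : Fin 24 → ℝ) k * v k
  map_add' a b := by funext k; simp only [Pi.add_apply]; ring
  map_smul' c v := by funext k; simp only [Pi.smul_apply, RingHom.id_apply, smul_eq_mul]; ring

/-- The matrix of a nilpotent derivation raising the weights of `weightDer`. -/
def raisingFun (v : Pt) : Pt :=
  ![0, 0, 0, 2 * v 2, -2 * v 0 - 2 * v 1, v 3, v 4, -v 4,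
    0, v 8, -v 8, v 9 - v 10, v 8, -v 9 - v 12, -v 10 - v 12, v 11 + v 13 + v 14,
    0, v 16, -v 16, v 17 - v 18, v 16, -v 17 - v 20, -v 18 - v 20, v 19 + v 21 + v 22]

/-- A nilpotent derivation raising the weights of `weightDer`. -/
def raisingDer : Module.End ℝ Pt where
  toFun := raisingFun
  map_add' a b := by
    funext k
    fin_cases k <;> simp [raisingFun] <;> ring
  map_smul' c v := by
    funext k
    fin_cases k <;> simp [raisingFun] <;> ring

lemma Jlin_apply (v : Pt) : Jlin v = ![0, 0, 0, 0, 0, 0, 0, 0,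
    -v 16, -v 17, -v 18, -v 19, -v 20, -v 21, -v 22, -v 23,
    v 8, v 9, v 10, v 11, v 12, v 13, v 14, v 15] := by
  funext k
  fin_cases k <;> simp [Jlin, Jfun]

section bracket

variable (v w : Pt)

lemma br_apply_zero : br v w 0 =
    -((v 8 * w 19 - v 19 * w 8) + (v 9 * w 18 - v 18 * w 9)
      + (v 10 * w 17 - v 17 * w 10) + (v 11 * w 16 - v 16 * w 11)) := rfl

lemma br_apply_one : br v w 1 =
    -((v 8 * w 21 - v 21 * w 8) + (v 9 * w 20 - v 20 * w 9)
      + (v 12 * w 17 - v 17 * w 12) + (v 13 * w 16 - v 16 * w 13)) := rfl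

lemma br_apply_two : br v w 2 =
    -((v 8 * w 14 - v 14 * w 8) - (v 10 * w 12 - v 12 * w 10)
      + (v 16 * w 22 - v 22 * w 16) - (v 18 * w 20 - v 20 * w 18)) := rfl

lemma br_apply_three : br v w 3 =
    -((v 8 * w 15 - v 15 * w 8) + (v 9 * w 14 - v 14 * w 9)
      + (v 10 * w 13 - v 13 * w 10) + (v 11 * w 12 - v 12 * w 11)
      + (v 16 * w 23 - v 23 * w 16) + (v 17 * w 22 - v 22 * w 17)
      + (v 18 * w 21 - v 21 * w 18) + (v 19 * w 20 - v 20 * w 19)) := rfl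

lemma br_apply_four : br v w 4 =
    -(-(v 8 * w 23 - v 23 * w 8) + (v 9 * w 22 - v 22 * w 9)
      + (v 10 * w 21 - v 21 * w 10) - (v 11 * w 20 - v 20 * w 11)
      - (v 12 * w 19 - v 19 * w 12) + (v 13 * w 18 - v 18 * w 13)
      + (v 14 * w 17 - v 17 * w 14) - (v 15 * w 16 - v 16 * w 15)) := rfl

lemma br_apply_five : br v w 5 =
    -((v 9 * w 15 - v 15 * w 9) - (v 11 * w 13 - v 13 * w 11)
      + (v 17 * w 23 - v 23 * w 17) - (v 19 * w 21 - v 21 * w 19)) := rfl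

lemma br_apply_six : br v w 6 =
    -((v 10 * w 23 - v 23 * w 10) + (v 11 * w 22 - v 22 * w 11)
      + (v 14 * w 19 - v 19 * w 14) + (v 15 * w 18 - v 18 * w 15)) := rfl

lemma br_apply_seven : br v w 7 =
    -((v 12 * w 23 - v 23 * w 12) + (v 13 * w 22 - v 22 * w 13)
      + (v 14 * w 21 - v 21 * w 14) + (v 15 * w 20 - v 20 * w 15)) := rfl

lemma br_apply_of_le {k : Fin 24} (hk : 8 ≤ (k : ℕ)) : br v w k = 0 :=
  dif_neg (by omega)

lemma br_sub_left (u : Pt) : br (u - v) w = br u w - br v w := by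
  funext k
  fin_cases k <;> simp [br_apply_zero, br_apply_one, br_apply_two, br_apply_three,
    br_apply_four, br_apply_five, br_apply_six, br_apply_seven, br_apply_of_le] <;> ring

lemma br_sub_right (u : Pt) : br v (w - u) = br v w - br v u := by
  funext k
  fin_cases k <;> simp [br_apply_zero, br_apply_one, br_apply_two, br_apply_three,
    br_apply_four, br_apply_five, br_apply_six, br_apply_seven, br_apply_of_le] <;> ring

end bracket

lemma Jlin_isSPDer : IsSPDer Jlin := by
  refine ⟨Jlin_mem_Nm1, fun v hv => ?_, fun v w => ?_⟩
  · have hv : ∀ k : Fin 24, 8 ≤ (k : ℕ) → v k = 0 := hv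
    show ∀ k : Fin 24, 8 ≤ (k : ℕ) → Jlin v k = 0
    intro k hk
    rw [Jlin_apply]
    fin_cases k <;> simp [hv] at hk ⊢
  · funext k
    fin_cases k <;> simp [Jlin_apply, br_apply_zero, br_apply_one, br_apply_two, br_apply_three,
      br_apply_four, br_apply_five, br_apply_six, br_apply_seven, br_apply_of_le] <;> ring

lemma weightDer_isSPDer : IsSPDer weightDer := by
  refine ⟨fun v hv => ?_, fun v hv => ?_, fun v w => ?_⟩
  · have hv : ∀ k : Fin 24, (k : ℕ) < 8 → v k = 0 := hv
    show ∀ k : Fin 24, (k : ℕ) < 8 → weightDer v k = 0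
    intro k hk
    simp [weightDer, hv k hk]
  · have hv : ∀ k : Fin 24, 8 ≤ (k : ℕ) → v k = 0 := hv
    show ∀ k : Fin 24, 8 ≤ (k : ℕ) → weightDer v k = 0
    intro k hk
    simp [weightDer, hv k hk]
  · funext k
    fin_cases k <;> simp [weightDer, br_apply_zero, br_apply_one, br_apply_two, br_apply_three,
      br_apply_four, br_apply_five, br_apply_six, br_apply_seven, br_apply_of_le] <;> ring

lemma raisingDer_isSPDer : IsSPDer raisingDer := by
  refine ⟨fun v hv => ?_, fun v hv => ?_, fun v w => ?_⟩
  · have hv : ∀ k : Fin 24, (k : ℕ) < 8 → v k = 0 := hv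
    show ∀ k : Fin 24, (k : ℕ) < 8 → raisingFun v k = 0
    intro k hk
    fin_cases k <;> simp [raisingFun, hv] at hk ⊢
  · have hv : ∀ k : Fin 24, 8 ≤ (k : ℕ) → v k = 0 := hv
    show ∀ k : Fin 24, 8 ≤ (k : ℕ) → raisingFun v k = 0
    intro k hk
    fin_cases k <;> simp [raisingFun, hv] at hk ⊢
  · funext k
    fin_cases k <;> simp [raisingDer, raisingFun, br_apply_zero, br_apply_one, br_apply_two, br_apply_three,
      br_apply_four, br_apply_five, br_apply_six, br_apply_seven, br_apply_of_le] <;> ring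

/-- The `j`-th basis vector, `X_{j+1}`. -/
abbrev basisVec (j : Fin 24) : Pt := Pi.single j 1

lemma Jlin_Jlin_of_mem {v : Pt} (hv : v ∈ Nm1) : Jlin (Jlin v) = -v := by
  have hv : ∀ k : Fin 24, (k : ℕ) < 8 → v k = 0 := hv
  rw [Jlin_apply, Jlin_apply]
  funext k
  fin_cases k <;> simp [hv]

lemma basisVec_mem_Nm1 {j : Fin 24} (hj : 8 ≤ (j : ℕ)) : basisVec j ∈ Nm1 := by
  show ∀ k : Fin 24, (k : ℕ) < 8 → basisVec j k = 0
  intro k hk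
  exact Pi.single_eq_of_ne (by rintro rfl; omega) _

lemma Jlin_basisVec {j : Fin 24} (h8 : 8 ≤ (j : ℕ)) (h16 : (j : ℕ) < 16) :
    Jlin (basisVec j) = basisVec (j + 8) := by
  rw [Jlin_apply]
  funext k
  fin_cases j <;> simp at h8 h16 <;> fin_cases k <;> simp [basisVec]

lemma exists_add_eight {k : Fin 24} (hk : 16 ≤ (k : ℕ)) :
    ∃ j : Fin 24, 8 ≤ (j : ℕ) ∧ (j : ℕ) < 16 ∧ k = j + 8 := by
  revert k
  decide

/-- A linear map killing `X_9, …, X_16` and their images under `J` vanishes on `n_{-1}`. -/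
lemma eq_zero_on_Nm1 {S : Module.End ℝ Pt}
    (h : ∀ j : Fin 24, 8 ≤ (j : ℕ) → (j : ℕ) < 16 → S (basisVec j) = 0)
    (hJ : ∀ j : Fin 24, 8 ≤ (j : ℕ) → (j : ℕ) < 16 → S (Jlin (basisVec j)) = 0)
    {v : Pt} (hv : v ∈ Nm1) : S v = 0 := by
  have hv : ∀ k : Fin 24, (k : ℕ) < 8 → v k = 0 := hv
  rw [pi_eq_sum_univ' v, map_sum]
  refine Finset.sum_eq_zero fun k _ => ?_
  rw [map_smul]
  rcases lt_or_ge (k : ℕ) 8 with h8 | h8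
  · rw [hv k h8, zero_smul]
  rcases lt_or_ge (k : ℕ) 16 with h16 | h16
  · rw [h k h8 h16, smul_zero]
  · obtain ⟨j, hj, hj', rfl⟩ := exists_add_eight h16
    have hs : S (basisVec (j + 8)) = 0 := by rw [← Jlin_basisVec hj hj', hJ j hj hj']
    exact smul_eq_zero_of_right _ hs

section radicals

variable (v : Pt)

lemma radical_zero : (∀ w, br v w 0 = 0) ↔ v 8 = 0 ∧ v 9 = 0 ∧ v 10 = 0 ∧ v 11 = 0 ∧
    v 16 = 0 ∧ v 17 = 0 ∧ v 18 = 0 ∧ v 19 = 0 := by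
  refine ⟨fun h => ⟨?_, ?_, ?_, ?_, ?_, ?_, ?_, ?_⟩, fun h w => by simp [br_apply_zero, h]⟩
  · simpa [br_apply_zero] using h (basisVec 19)
  · simpa [br_apply_zero] using h (basisVec 18)
  · simpa [br_apply_zero] using h (basisVec 17)
  · simpa [br_apply_zero] using h (basisVec 16)
  · simpa [br_apply_zero] using h (basisVec 11)
  · simpa [br_apply_zero] using h (basisVec 10)
  · simpa [br_apply_zero] using h (basisVec 9)
  · simpa [br_apply_zero] using h (basisVec 8)

lemma radical_one : (∀ w, br v w 1 = 0) ↔ v 8 = 0 ∧ v 9 = 0 ∧ v 12 = 0 ∧ v 13 = 0 ∧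
    v 16 = 0 ∧ v 17 = 0 ∧ v 20 = 0 ∧ v 21 = 0 := by
  refine ⟨fun h => ⟨?_, ?_, ?_, ?_, ?_, ?_, ?_, ?_⟩, fun h w => by simp [br_apply_one, h]⟩
  · simpa [br_apply_one] using h (basisVec 21)
  · simpa [br_apply_one] using h (basisVec 20)
  · simpa [br_apply_one] using h (basisVec 17)
  · simpa [br_apply_one] using h (basisVec 16)
  · simpa [br_apply_one] using h (basisVec 13)
  · simpa [br_apply_one] using h (basisVec 12)
  · simpa [br_apply_one] using h (basisVec 9)
  · simpa [br_apply_one] using h (basisVec 8)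

lemma radical_two : (∀ w, br v w 2 = 0) ↔ v 8 = 0 ∧ v 10 = 0 ∧ v 12 = 0 ∧ v 14 = 0 ∧
    v 16 = 0 ∧ v 18 = 0 ∧ v 20 = 0 ∧ v 22 = 0 := by
  refine ⟨fun h => ⟨?_, ?_, ?_, ?_, ?_, ?_, ?_, ?_⟩, fun h w => by simp [br_apply_two, h]⟩
  · simpa [br_apply_two] using h (basisVec 14)
  · simpa [br_apply_two] using h (basisVec 12)
  · simpa [br_apply_two] using h (basisVec 10)
  · simpa [br_apply_two] using h (basisVec 8)
  · simpa [br_apply_two] using h (basisVec 22)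
  · simpa [br_apply_two] using h (basisVec 20)
  · simpa [br_apply_two] using h (basisVec 18)
  · simpa [br_apply_two] using h (basisVec 16)

lemma radical_five : (∀ w, br v w 5 = 0) ↔ v 9 = 0 ∧ v 11 = 0 ∧ v 13 = 0 ∧ v 15 = 0 ∧
    v 17 = 0 ∧ v 19 = 0 ∧ v 21 = 0 ∧ v 23 = 0 := by
  refine ⟨fun h => ⟨?_, ?_, ?_, ?_, ?_, ?_, ?_, ?_⟩, fun h w => by simp [br_apply_five, h]⟩
  · simpa [br_apply_five] using h (basisVec 15)
  · simpa [br_apply_five] using h (basisVec 13)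
  · simpa [br_apply_five] using h (basisVec 11)
  · simpa [br_apply_five] using h (basisVec 9)
  · simpa [br_apply_five] using h (basisVec 23)
  · simpa [br_apply_five] using h (basisVec 21)
  · simpa [br_apply_five] using h (basisVec 19)
  · simpa [br_apply_five] using h (basisVec 17)

lemma radical_six : (∀ w, br v w 6 = 0) ↔ v 10 = 0 ∧ v 11 = 0 ∧ v 14 = 0 ∧ v 15 = 0 ∧
    v 18 = 0 ∧ v 19 = 0 ∧ v 22 = 0 ∧ v 23 = 0 := by
  refine ⟨fun h => ⟨?_, ?_, ?_, ?_, ?_, ?_, ?_, ?_⟩, fun h w => by simp [br_apply_six, h]⟩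
  · simpa [br_apply_six] using h (basisVec 23)
  · simpa [br_apply_six] using h (basisVec 22)
  · simpa [br_apply_six] using h (basisVec 19)
  · simpa [br_apply_six] using h (basisVec 18)
  · simpa [br_apply_six] using h (basisVec 15)
  · simpa [br_apply_six] using h (basisVec 14)
  · simpa [br_apply_six] using h (basisVec 11)
  · simpa [br_apply_six] using h (basisVec 10)

lemma radical_seven : (∀ w, br v w 7 = 0) ↔ v 12 = 0 ∧ v 13 = 0 ∧ v 14 = 0 ∧ v 15 = 0 ∧
    v 20 = 0 ∧ v 21 = 0 ∧ v 22 = 0 ∧ v 23 = 0 := by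
  refine ⟨fun h => ⟨?_, ?_, ?_, ?_, ?_, ?_, ?_, ?_⟩, fun h w => by simp [br_apply_seven, h]⟩
  · simpa [br_apply_seven] using h (basisVec 23)
  · simpa [br_apply_seven] using h (basisVec 22)
  · simpa [br_apply_seven] using h (basisVec 21)
  · simpa [br_apply_seven] using h (basisVec 20)
  · simpa [br_apply_seven] using h (basisVec 15)
  · simpa [br_apply_seven] using h (basisVec 14)
  · simpa [br_apply_seven] using h (basisVec 13)
  · simpa [br_apply_seven] using h (basisVec 12)

end radicals

lemma eq_zero_of_mem_Nm1 {v : Pt} (hv : v ∈ Nm1) (h : v 8 = 0 ∧ v 9 = 0 ∧ v 10 = 0 ∧ v 11 = 0 ∧ v 12 = 0 ∧ v 13 = 0 ∧ v 14 = 0 ∧ v 15 = 0 ∧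
    v 16 = 0 ∧ v 17 = 0 ∧ v 18 = 0 ∧ v 19 = 0 ∧ v 20 = 0 ∧ v 21 = 0 ∧ v 22 = 0 ∧ v 23 = 0) :
    v = 0 := by
  have hv : ∀ k : Fin 24, (k : ℕ) < 8 → v k = 0 := hv
  funext k
  fin_cases k <;> simp [h, hv]

/-- A `J`-antilinear endomorphism of `n_{-1}` that is skew for the bracket vanishes. -/
lemma eq_zero_of_skew {B : Module.End ℝ Pt} (hmem : ∀ v ∈ Nm1, B v ∈ Nm1)
    (hB : ∀ v w, br (B v) w + br v (B w) = 0) (hJ : ∀ v ∈ Nm1, B (Jlin v) = -Jlin (B v))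
    {v : Pt} (hv : v ∈ Nm1) : B v = 0 := by
  have rad {v : Pt} {k : Fin 24} (h : ∀ w, br v w k = 0) (w : Pt) : br (B v) w k = 0 := by
    simpa [h] using congrFun (hB v w) k
  have skew (k i j : Fin 24) :
      br (B (basisVec i)) (basisVec j) k + br (basisVec i) (B (basisVec j)) k = 0 :=
    congrFun (hB _ _) k
  have Bconj {j : Fin 24} (h8 : 8 ≤ (j : ℕ)) (h16 : (j : ℕ) < 16) :
      B (basisVec (j + 8)) = -Jlin (B (basisVec j)) := by
    rw [← Jlin_basisVec h8 h16, hJ _ (basisVec_mem_Nm1 h8)]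
  have conj10 : B (basisVec 18) = -Jlin (B (basisVec 10)) :=
    Bconj (j := 10) (by decide) (by decide)
  have conj11 : B (basisVec 19) = -Jlin (B (basisVec 11)) :=
    Bconj (j := 11) (by decide) (by decide)
  have conj12 : B (basisVec 20) = -Jlin (B (basisVec 12)) :=
    Bconj (j := 12) (by decide) (by decide)
  have conj14 : B (basisVec 22) = -Jlin (B (basisVec 14)) :=
    Bconj (j := 14) (by decide) (by decide)
  have conj15 : B (basisVec 23) = -Jlin (B (basisVec 15)) :=
    Bconj (j := 15) (by decide) (by decide)
  have s8_19 := skew 0 8 19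
  have s8_11 := skew 0 8 11
  have s11_22 := skew 6 11 22
  have s11_14 := skew 6 11 14
  have s8_14 := skew 2 8 14
  have s8_22 := skew 2 8 22
  have s13_22 := skew 7 13 22
  have s13_14 := skew 7 13 14
  have s9_18 := skew 0 9 18
  have s9_10 := skew 0 9 10
  have s10_23 := skew 6 10 23
  have s10_15 := skew 6 10 15
  have s9_15 := skew 5 9 15
  have s9_23 := skew 5 9 23
  have s9_20 := skew 1 9 20
  have s9_12 := skew 1 9 12
  simp [br_apply_zero, conj11, Jlin_apply] at s8_19
  simp [br_apply_zero] at s8_11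
  simp [br_apply_six, conj14, Jlin_apply] at s11_22
  simp [br_apply_six] at s11_14
  simp [br_apply_two] at s8_14
  simp [br_apply_two, conj14, Jlin_apply] at s8_22
  simp [br_apply_seven, conj14, Jlin_apply] at s13_22
  simp [br_apply_seven] at s13_14
  simp [br_apply_zero, conj10, Jlin_apply] at s9_18
  simp [br_apply_zero] at s9_10
  simp [br_apply_six, conj15, Jlin_apply] at s10_23
  simp [br_apply_six] at s10_15
  simp [br_apply_five] at s9_15
  simp [br_apply_five, conj15, Jlin_apply] at s9_23
  simp [br_apply_one, conj12, Jlin_apply] at s9_20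
  simp [br_apply_one] at s9_12
  have h8 : B (basisVec 8) = 0 := by
    have r0 := (radical_five _).1 (rad ((radical_five (basisVec 8)).2 (by simp)))
    have r1 := (radical_six _).1 (rad ((radical_six (basisVec 8)).2 (by simp)))
    have r2 := (radical_seven _).1 (rad ((radical_seven (basisVec 8)).2 (by simp)))
    have d0 : B (basisVec 8) 8 = 0 := by linarith
    have d1 : B (basisVec 8) 16 = 0 := by linarith
    exact eq_zero_of_mem_Nm1 (hmem _ (basisVec_mem_Nm1 (by decide))) (by tauto)
  have h9 : B (basisVec 9) = 0 := by
    have r0 := (radical_two _).1 (rad ((radical_two (basisVec 9)).2 (by simp)))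
    have r1 := (radical_six _).1 (rad ((radical_six (basisVec 9)).2 (by simp)))
    have r2 := (radical_seven _).1 (rad ((radical_seven (basisVec 9)).2 (by simp)))
    have d0 : B (basisVec 9) 9 = 0 := by linarith
    have d1 : B (basisVec 9) 17 = 0 := by linarith
    exact eq_zero_of_mem_Nm1 (hmem _ (basisVec_mem_Nm1 (by decide))) (by tauto)
  have h10 : B (basisVec 10) = 0 := by
    have r0 := (radical_one _).1 (rad ((radical_one (basisVec 10)).2 (by simp)))
    have r1 := (radical_five _).1 (rad ((radical_five (basisVec 10)).2 (by simp)))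
    have r2 := (radical_seven _).1 (rad ((radical_seven (basisVec 10)).2 (by simp)))
    have d0 : B (basisVec 10) 10 = 0 := by linarith
    have d1 : B (basisVec 10) 18 = 0 := by linarith
    exact eq_zero_of_mem_Nm1 (hmem _ (basisVec_mem_Nm1 (by decide))) (by tauto)
  have h11 : B (basisVec 11) = 0 := by
    have r0 := (radical_one _).1 (rad ((radical_one (basisVec 11)).2 (by simp)))
    have r1 := (radical_two _).1 (rad ((radical_two (basisVec 11)).2 (by simp)))
    have r2 := (radical_seven _).1 (rad ((radical_seven (basisVec 11)).2 (by simp)))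
    have d0 : B (basisVec 11) 11 = 0 := by linarith
    have d1 : B (basisVec 11) 19 = 0 := by linarith
    exact eq_zero_of_mem_Nm1 (hmem _ (basisVec_mem_Nm1 (by decide))) (by tauto)
  have h12 : B (basisVec 12) = 0 := by
    have r0 := (radical_zero _).1 (rad ((radical_zero (basisVec 12)).2 (by simp)))
    have r1 := (radical_five _).1 (rad ((radical_five (basisVec 12)).2 (by simp)))
    have r2 := (radical_six _).1 (rad ((radical_six (basisVec 12)).2 (by simp)))
    have d0 : B (basisVec 12) 12 = 0 := by linarith
    have d1 : B (basisVec 12) 20 = 0 := by linarith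
    exact eq_zero_of_mem_Nm1 (hmem _ (basisVec_mem_Nm1 (by decide))) (by tauto)
  have h13 : B (basisVec 13) = 0 := by
    have r0 := (radical_zero _).1 (rad ((radical_zero (basisVec 13)).2 (by simp)))
    have r1 := (radical_two _).1 (rad ((radical_two (basisVec 13)).2 (by simp)))
    have r2 := (radical_six _).1 (rad ((radical_six (basisVec 13)).2 (by simp)))
    have d0 : B (basisVec 13) 13 = 0 := by linarith
    have d1 : B (basisVec 13) 21 = 0 := by linarith
    exact eq_zero_of_mem_Nm1 (hmem _ (basisVec_mem_Nm1 (by decide))) (by tauto)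
  have h14 : B (basisVec 14) = 0 := by
    have r0 := (radical_zero _).1 (rad ((radical_zero (basisVec 14)).2 (by simp)))
    have r1 := (radical_one _).1 (rad ((radical_one (basisVec 14)).2 (by simp)))
    have r2 := (radical_five _).1 (rad ((radical_five (basisVec 14)).2 (by simp)))
    have d0 : B (basisVec 14) 14 = 0 := by linarith
    have d1 : B (basisVec 14) 22 = 0 := by linarith
    exact eq_zero_of_mem_Nm1 (hmem _ (basisVec_mem_Nm1 (by decide))) (by tauto)
  have h15 : B (basisVec 15) = 0 := by
    have r0 := (radical_zero _).1 (rad ((radical_zero (basisVec 15)).2 (by simp)))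
    have r1 := (radical_one _).1 (rad ((radical_one (basisVec 15)).2 (by simp)))
    have r2 := (radical_two _).1 (rad ((radical_two (basisVec 15)).2 (by simp)))
    have d0 : B (basisVec 15) 15 = 0 := by linarith
    have d1 : B (basisVec 15) 23 = 0 := by linarith
    exact eq_zero_of_mem_Nm1 (hmem _ (basisVec_mem_Nm1 (by decide))) (by tauto)
  have h : ∀ j : Fin 24, 8 ≤ (j : ℕ) → (j : ℕ) < 16 → B (basisVec j) = 0 := by
    intro j hj hj'
    fin_cases j <;> simp at hj hj' <;> assumption
  refine eq_zero_on_Nm1 h (fun j hj hj' => ?_) hv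
  rw [hJ _ (basisVec_mem_Nm1 hj), h j hj hj', map_zero, neg_zero]

/-- Every strata-preserving derivation is `J`-linear on `n_{-1}`. -/
lemma IsSPDer.apply_Jlin {A : Module.End ℝ Pt} (hA : IsSPDer A) {v : Pt} (hv : v ∈ Nm1) :
    A (Jlin v) = Jlin (A v) := by
  have hbr : ∀ v w, br (Jlin v) w + br v (Jlin w) = 0 := fun v w => by
    rw [← Jlin_isSPDer.2.2, Jlin_apply]
    funext k
    fin_cases k <;> simp [br_apply_of_le]
  have hsub : (A * Jlin - Jlin * A : Module.End ℝ Pt) v = 0 := by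
    refine eq_zero_of_skew (fun v hv => ?_) (fun v w => ?_) (fun v hv => ?_) hv
    · exact Nm1.sub_mem (hA.1 _ (Jlin_mem_Nm1 _ hv)) (Jlin_mem_Nm1 _ (hA.1 _ hv))
    · have h1 := hA.2.2 (Jlin v) w
      have h2 := hA.2.2 v (Jlin w)
      have h3 := hbr (A v) w
      have h4 := hbr v (A w)
      have h5 := congrArg A (hbr v w)
      rw [map_add, map_zero] at h5
      simp only [LinearMap.sub_apply, Module.End.mul_apply, br_sub_left, br_sub_right]
      linear_combination (norm := module) h5 - h1 - h2 - h3 - h4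
    · have h1 := Jlin_Jlin_of_mem hv
      have h2 := Jlin_Jlin_of_mem (hA.1 v hv)
      simp [h1, h2, sub_eq_add_neg]
  exact sub_eq_zero.1 hsub

/-- A linear map commuting with `weightDer`, `raisingDer` and `J` which kills `X_9` vanishes
on `n_{-1}`. -/
lemma eq_zero_of_commute {S : Module.End ℝ Pt} (hW : ∀ v, S (weightDer v) = weightDer (S v))
    (hR : ∀ v, S (raisingDer v) = raisingDer (S v)) (hJ : ∀ v, S (Jlin v) = Jlin (S v))
    (h8 : S (basisVec 8) = 0) {v : Pt} (hv : v ∈ Nm1) : S v = 0 := by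
  have kerW {v : Pt} (h : S v = 0) : S (weightDer v) = 0 := by rw [hW, h, map_zero]
  have kerR {v : Pt} (h : S v = 0) : S (raisingDer v) = 0 := by rw [hR, h, map_zero]
  have raise8 : raisingDer (basisVec 8) = basisVec 9 - basisVec 10 + basisVec 12 := by
    funext k
    fin_cases k <;> simp [raisingDer, raisingFun]
  have raise9 : raisingDer (basisVec 9) = basisVec 11 - basisVec 13 := by
    funext k
    fin_cases k <;> simp [raisingDer, raisingFun]
  have raise10 : raisingDer (basisVec 10) = -basisVec 11 - basisVec 14 := by
    funext k
    fin_cases k <;> simp [raisingDer, raisingFun]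
  have raise11 : raisingDer (basisVec 11) = basisVec 15 := by
    funext k
    fin_cases k <;> simp [raisingDer, raisingFun]
  have weight (j : Fin 24) : weightDer (basisVec j) = (![3, 5, 6, 7, 7, 8, 9, 11,
      0, 1, 2, 3, 4, 5, 6, 7, 0, 1, 2, 3, 4, 5, 6, 7] : Fin 24 → ℝ) j • basisVec j := by
    funext k
    by_cases hk : k = j
    · subst hk; simp [weightDer]
    · simp [weightDer, hk]
  have e1 := kerR h8
  have e2 := kerW e1
  have e3 := kerW e2
  simp only [raise8, map_add, map_sub, weight, map_smul, Matrix.cons_val] at e1 e2 e3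
  have h9 : S (basisVec 9) = 0 := by
    linear_combination (norm := module) (8 / 3 : ℝ) • e1 - (2 : ℝ) • e2 + (1 / 3 : ℝ) • e3
  have h10 : S (basisVec 10) = 0 := by
    linear_combination (norm := module) (2 : ℝ) • e1 - (5 / 2 : ℝ) • e2 + (1 / 2 : ℝ) • e3
  have h12 : S (basisVec 12) = 0 := by
    linear_combination (norm := module) (1 / 3 : ℝ) • e1 - (1 / 2 : ℝ) • e2 + (1 / 6 : ℝ) • e3
  have f1 := kerR h9
  have f2 := kerW f1
  simp only [raise9, map_sub, weight, map_smul, Matrix.cons_val] at f1 f2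
  have h11 : S (basisVec 11) = 0 := by
    linear_combination (norm := module) (5 / 2 : ℝ) • f1 - (1 / 2 : ℝ) • f2
  have h13 : S (basisVec 13) = 0 := by
    linear_combination (norm := module) (3 / 2 : ℝ) • f1 - (1 / 2 : ℝ) • f2
  have h14 : S (basisVec 14) = 0 := by
    have g := kerR h10
    rw [raise10, map_sub, map_neg, h11] at g
    simpa using g
  have h15 : S (basisVec 15) = 0 := raise11 ▸ kerR h11
  have h : ∀ j : Fin 24, 8 ≤ (j : ℕ) → (j : ℕ) < 16 → S (basisVec j) = 0 := by
    intro j hj hj'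
    fin_cases j <;> simp at hj hj' <;> assumption
  exact eq_zero_on_Nm1 h (fun j hj hj' => by rw [hJ, h j hj hj', map_zero]) hv

/-- The projection onto `n_{-1}` along `n_{-2}`. -/
def projNm1 : Pt →ₗ[ℝ] ↥Nm1 where
  toFun v := ⟨fun k => if (k : ℕ) < 8 then 0 else v k, fun k hk => if_pos hk⟩
  map_add' a b := by
    ext k
    by_cases hk : (k : ℕ) < 8 <;> simp [hk]
  map_smul' c v := by
    ext k
    by_cases hk : (k : ℕ) < 8 <;> simp [hk]

lemma projNm1_coe (v : ↥Nm1) : projNm1 v = v := by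
  have hv : ∀ k : Fin 24, (k : ℕ) < 8 → (v : Pt) k = 0 := v.2
  ext k
  by_cases hk : (k : ℕ) < 8 <;> simp [projNm1, hk, hv]

lemma projNm1_of_mem_Nm2 {v : Pt} (hv : v ∈ Nm2) : projNm1 v = 0 := by
  have hv : ∀ k : Fin 24, 8 ≤ (k : ℕ) → v k = 0 := hv
  ext k
  by_cases hk : (k : ℕ) < 8
  · simp [projNm1, hk]
  · simp [projNm1, hk, hv k (not_lt.1 hk)]

lemma sub_projNm1_mem_Nm2 (v : Pt) : v - projNm1 v ∈ Nm2 := by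
  show ∀ k : Fin 24, 8 ≤ (k : ℕ) → (v - projNm1 v) k = 0
  intro k hk
  simp [projNm1, not_lt.2 hk]

lemma IsSPDer.projNm1_apply {A : Module.End ℝ Pt} (hA : IsSPDer A) (v : Pt) :
    projNm1 (A v) = A.restrict hA.1 (projNm1 v) := by
  have h := projNm1_of_mem_Nm2 (hA.2.1 _ (sub_projNm1_mem_Nm2 v))
  rw [map_sub, map_sub, sub_eq_zero] at h
  rw [h]
  exact projNm1_coe (A.restrict hA.1 (projNm1 v))

lemma weightDer_Jlin (v : Pt) : weightDer (Jlin v) = Jlin (weightDer v) := by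
  funext k
  fin_cases k <;> simp [Jlin_apply, weightDer]

lemma raisingDer_Jlin (v : Pt) : raisingDer (Jlin v) = Jlin (raisingDer v) := by
  funext k
  fin_cases k <;> simp [Jlin_apply, raisingDer, raisingFun] <;> ring

/-- An endomorphism of `n_{-1}` commuting with all strata-preserving derivations is a real
combination of the identity and `J`. -/
lemma eq_smul_one_add_smul_JN1 {T : Module.End ℝ ↥Nm1}
    (hT : ∀ (A : Module.End ℝ Pt) (hA : IsSPDer A), Commute T (A.restrict hA.1)) :
    ∃ α β : ℝ, T = α • (1 : Module.End ℝ ↥Nm1) + β • JN1 := by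
  set T' : Module.End ℝ Pt := Nm1.subtype ∘ₗ T ∘ₗ projNm1 with hT'
  have hcomm {A : Module.End ℝ Pt} (hA : IsSPDer A) (v : Pt) : T' (A v) = A (T' v) := by
    have h := LinearMap.congr_fun (hT A hA).eq (projNm1 v)
    simp only [Module.End.mul_apply] at h
    simp [hT', hA.projNm1_apply, h]
  have hmem : T' (basisVec 8) ∈ Nm1 := (T (projNm1 (basisVec 8))).2
  have hwt : weightDer (T' (basisVec 8)) = 0 := by
    have h0 : weightDer (basisVec 8) = 0 := by
      funext k
      by_cases hk : k = 8
      · subst hk; simp [weightDer]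
      · simp [weightDer, hk]
    rw [← hcomm weightDer_isSPDer, h0, map_zero]
  set S : Module.End ℝ Pt :=
    T' - T' (basisVec 8) 8 • (1 : Module.End ℝ Pt) - T' (basisVec 8) 16 • Jlin with hS
  have h8 : S (basisVec 8) = 0 := by
    have hlow : ∀ k : Fin 24, (k : ℕ) < 8 → T' (basisVec 8) k = 0 := hmem
    have hw (k : Fin 24) : weightDer (T' (basisVec 8)) k = 0 := congrFun hwt k
    have hJ : Jlin (basisVec 8) = basisVec 16 := Jlin_basisVec (j := 8) (by decide) (by decide)
    funext k
    have hk := hw k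
    fin_cases k <;> simp [weightDer] at hk <;> simp [hS, hJ, hlow, hk]
  refine ⟨T' (basisVec 8) 8, T' (basisVec 8) 16, LinearMap.ext fun v => Subtype.ext ?_⟩
  have h := eq_zero_of_commute (S := S)
    (fun v => by simp [hS, hcomm weightDer_isSPDer, weightDer_Jlin])
    (fun v => by simp [hS, hcomm raisingDer_isSPDer, raisingDer_Jlin])
    (fun v => by simp [hS, hcomm Jlin_isSPDer]) h8 v.2
  have hv : T' v = T v := by simp [hT', projNm1_coe]
  rw [hS, LinearMap.sub_apply, LinearMap.sub_apply, hv, sub_sub, sub_eq_zero] at h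
  exact h

lemma JN1_mul_JN1 : JN1 * JN1 = -1 :=
  LinearMap.ext fun v => Subtype.ext (Jlin_Jlin_of_mem v.2)

/-- The commutant, inside the endomorphisms of `n_{-1}`, of the restrictions to `n_{-1}`
of all strata-preserving derivations of `n_{E_II}` is exactly `{α·id + β·J}`; in
particular `J² = -id`, `J` commutes with every such restriction, and the only elements
`T` of the commutant with `T² = -id` are `T = J` and `T = -J`: the nilpotent Lie algebra
`n_{E_II}` canonically determines a complex structure on `n_{-1}`, unique up to sign. -/
theorem nEII_canonical_complex_structure :
    JN1 * JN1 = -1 ∧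
    ({T : Module.End ℝ ↥Nm1 | ∀ (A : Module.End ℝ Pt) (hA : IsSPDer A),
        Commute T (A.restrict hA.1)} =
      {T : Module.End ℝ ↥Nm1 | ∃ α β : ℝ,
        T = α • (1 : Module.End ℝ ↥Nm1) + β • JN1}) ∧
    ∀ T : Module.End ℝ ↥Nm1,
      (∀ (A : Module.End ℝ Pt) (hA : IsSPDer A), Commute T (A.restrict hA.1)) →
      T * T = -1 → (T = JN1 ∨ T = -JN1) := by
  refine ⟨JN1_mul_JN1, Set.ext fun T => ⟨eq_smul_one_add_smul_JN1, ?_⟩, fun T hT hsq => ?_⟩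
  · rintro ⟨α, β, rfl⟩ A hA
    have hJ : Commute JN1 (A.restrict hA.1) :=
      LinearMap.ext fun v => Subtype.ext (hA.apply_Jlin v.2).symm
    exact ((Commute.one_left _).smul_left α).add_left (hJ.smul_left β)
  · obtain ⟨α, β, rfl⟩ := eq_smul_one_add_smul_JN1 hT
    have hmul : (α • (1 : Module.End ℝ ↥Nm1) + β • JN1) * (α • 1 + β • JN1) =
        (α * α) • 1 + (2 * α * β) • JN1 + (β * β) • (JN1 * JN1) := by
      simp only [add_mul, mul_add, smul_mul_smul_comm, one_mul, mul_one]
      module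
    rw [hmul, JN1_mul_JN1] at hsq
    have hv := congrArg Subtype.val
      (LinearMap.congr_fun hsq ⟨basisVec 8, basisVec_mem_Nm1 (by decide)⟩)
    have hJ : ((JN1 ⟨basisVec 8, basisVec_mem_Nm1 (by decide)⟩ : ↥Nm1) : Pt) = basisVec 16 :=
      Jlin_basisVec (j := 8) (by decide) (by decide)
    have hre : α * α + -(β * β) = -1 := by simpa [hJ] using congrFun hv 8
    have him : α = 0 ∨ β = 0 := by simpa [hJ] using congrFun hv 16
    have hα : α = 0 := him.resolve_right fun hβ => by subst hβ; nlinarith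
    subst hα
    have hβ : β = 1 ∨ β = -1 := mul_self_eq_one_iff.1 (by linarith)
    rw [zero_smul, zero_add]
    rcases hβ with rfl | rfl
    · exact Or.inl (one_smul ℝ JN1)
    · exact Or.inr (neg_one_smul ℝ JN1)
end
end

section
/- On the degree −1 stratum n_{−1} of the nilpotent Lie algebra n_{E_II}, the canonical complex structure J defined by J(X_{8+i}) = X_{16+i}, J(X_{16+i}) = −X_{8+i} (i = 1,…,8) is compatible with the bracket in the Levi–Tanaka (partial integrability) sense: [Jv, Jw] = [v, w] for all v, w ∈ n_{−1}; consequently also [Jv, w] + [v, Jw] = 0 for all v, w ∈ n_{−1}. -/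
noncomputable section
open ComplexConjugate

/-- The stratum `n_{-1} = span (X_9, …, X_24)`, as a set. -/
def Nm1set : Set Pt := {v | ∀ k : Fin 24, (k : ℕ) < 8 → v k = 0}

/-- On the stratum `n_{-1}` of `n_{E_II}`, the canonical complex structure `J` is
compatible with the bracket in the Levi–Tanaka (partial integrability) sense:
`[J v, J w] = [v, w]`, and consequently `[J v, w] + [v, J w] = 0`. -/
theorem nEII_J_partial_integrability :
    ∀ v ∈ Nm1set, ∀ w ∈ Nm1set,
      br (Jfun v) (Jfun w) = br v w ∧ br (Jfun v) w + br v (Jfun w) = 0 := by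
  intro v _ w _
  have h : ∀ u : Pt, Jfun u 8 = -u 16 ∧ Jfun u 9 = -u 17 ∧ Jfun u 10 = -u 18 ∧
      Jfun u 11 = -u 19 ∧ Jfun u 12 = -u 20 ∧ Jfun u 13 = -u 21 ∧ Jfun u 14 = -u 22 ∧
      Jfun u 15 = -u 23 ∧ Jfun u 16 = u 8 ∧ Jfun u 17 = u 9 ∧ Jfun u 18 = u 10 ∧
      Jfun u 19 = u 11 ∧ Jfun u 20 = u 12 ∧ Jfun u 21 = u 13 ∧ Jfun u 22 = u 14 ∧
      Jfun u 23 = u 15 := fun u => by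
    refine ⟨rfl, rfl, rfl, rfl, rfl, rfl, rfl, rfl, rfl, rfl, rfl, rfl, rfl, rfl, rfl, rfl⟩
  constructor <;> ext k <;> by_cases hk : (k : ℕ) < 8
  · simp only [br, hk, dif_pos, h]
    generalize (⟨(k : ℕ), hk⟩ : Fin 8) = i
    fin_cases i <;> simp <;> ring
  · simp only [br, hk, dif_neg, not_false_eq_true]
  · simp only [Pi.add_apply, Pi.zero_apply, br, hk, dif_pos, h]
    generalize (⟨(k : ℕ), hk⟩ : Fin 8) = i
    fin_cases i <;> simp <;> ring
  · simp [br, hk]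
end
end

section
/- For every ℓ ≥ 4, each of the following holomorphic vector fields Y on C^{ℓ(ℓ−1)/2} is an infinitesimal CR symmetry of M^{N(ℓ)}, i.e. the real vector field Y + conj(Y) is tangent to M^{N(ℓ)} at every point of M^{N(ℓ)}: (i) Y^{−2}_{w^{ij}} = ∂/∂w^{ij} for 1 ≤ i < j ≤ ℓ−1; (ii) Y^{−1}_{z^i} = ∂/∂z^i + Σ_{1≤k<i} z^k ∂/∂w^{ki} − Σ_{i<k≤ℓ−1} z^k ∂/∂w^{ik}, and IY^{−1}_{z^i} = i·∂/∂z^i − Σ_{1≤k<i} i·z^k ∂/∂w^{ki} + Σ_{i<k≤ℓ−1} i·z^k ∂/∂w^{ik}, for 1 ≤ i ≤ ℓ−1; (iii) for 1 ≤ i < j ≤ ℓ−1: Y^0_{ij} = z^i ∂/∂z^j + Σ_{1≤k<i} w^{ki} ∂/∂w^{kj} − Σ_{i<k<j} w^{ik} ∂/∂w^{kj} + Σ_{j<k≤ℓ−1} w^{ik} ∂/∂w^{jk}; (iv) for 1 ≤ i ≤ ℓ−1: Y^0_{ii} = z^i ∂/∂z^i + Σ_{1≤k<i} w^{ki} ∂/∂w^{ki}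 + Σ_{i<k≤ℓ−1} w^{ik} ∂/∂w^{ik}; (v) for 1 ≤ j < i ≤ ℓ−1: Y^0_{ij} = z^i ∂/∂z^j + Σ_{1≤k<j} w^{ki} ∂/∂w^{kj} − Σ_{j<k<i} w^{ki} ∂/∂w^{jk} + Σ_{i<k≤ℓ−1} w^{ik} ∂/∂w^{jk}; (vi) the rotation R = i·(z^1 ∂/∂z^1 + … + z^{ℓ−1} ∂/∂z^{ℓ−1}). -/
noncomputable section
open ComplexConjugate

/-- Index set for the coordinates `w^{ij}`, `1 ≤ i < j ≤ n` (with `n = ℓ - 1`). -/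
abbrev soIdx (n : ℕ) : Type := {q : Fin n × Fin n // q.1 < q.2}

/-- The ambient complex vector space `ℂ^{ℓ(ℓ-1)/2}` with holomorphic coordinates
`(w, z) = ((w^{ij})_{i<j}, (z^k))`, where `n = ℓ - 1`. -/
abbrev soAmb (n : ℕ) : Type := (soIdx n → ℂ) × (Fin n → ℂ)

/-- The real defining functions `ρ^{ij} = Im (w^{ij} - z^i conj (z^j))` of `M^{N(ℓ)}`. -/
def rho (n : ℕ) (ij : soIdx n) (p : soAmb n) : ℝ :=
  (p.1 ij - p.2 ij.1.1 * conj (p.2 ij.1.2)).im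

/-- A holomorphic vector field `Y = Σ W_{ij} ∂/∂w^{ij} + Σ Z_i ∂/∂z^i`, recorded by the
values of its coefficient functions, is an infinitesimal CR symmetry of `M^{N(ℓ)}` when
the real vector field `Y + conj Y` is tangent to `M^{N(ℓ)}`: at every point `p` of
`M^{N(ℓ)}`, the derivative of each defining function `ρ^{ij}` at `p` in the real
direction whose complex coordinates are the coefficients of `Y` at `p` vanishes. -/
def IsInfCRSym (n : ℕ) (V : soAmb n → soAmb n) : Prop :=
  ∀ p : soAmb n, (∀ ij : soIdx n, rho n ij p = 0) →
    ∀ ij : soIdx n, fderiv ℝ (rho n ij) p (V p) = 0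

/-- The degree `-2` generator `Y^{-2}_{w^{ij}} = ∂/∂w^{ij}`. -/
def Yw (n : ℕ) (ij : soIdx n) : soAmb n → soAmb n :=
  fun _ => ((Pi.single ij 1 : soIdx n → ℂ), (0 : Fin n → ℂ))

/-- The degree `-1` generator
`Y^{-1}_{z^i} = ∂/∂z^i + Σ_{k<i} z^k ∂/∂w^{ki} - Σ_{i<k} z^k ∂/∂w^{ik}`. -/
def Yz (n : ℕ) (i : Fin n) : soAmb n → soAmb n := fun p =>
  ((fun kl => if kl.1.2 = i then p.2 kl.1.1
      else if kl.1.1 = i then -(p.2 kl.1.2) else 0),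
    Pi.single i 1)

/-- The degree `-1` generator
`IY^{-1}_{z^i} = i·∂/∂z^i - Σ_{k<i} i·z^k ∂/∂w^{ki} + Σ_{i<k} i·z^k ∂/∂w^{ik}`. -/
def IYz (n : ℕ) (i : Fin n) : soAmb n → soAmb n := fun p =>
  ((fun kl => if kl.1.2 = i then -(Complex.I * p.2 kl.1.1)
      else if kl.1.1 = i then Complex.I * p.2 kl.1.2 else 0),
    Pi.single i Complex.I)

/-- The degree `0` generator for `i < j`:
`Y⁰_{ij} = z^i ∂/∂z^j + Σ_{k<i} w^{ki} ∂/∂w^{kj} - Σ_{i<k<j} w^{ik} ∂/∂w^{kj}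
  + Σ_{j<k} w^{ik} ∂/∂w^{jk}`. -/
def Y0lt (n : ℕ) (i j : Fin n) : soAmb n → soAmb n := fun p =>
  ((fun ab =>
      if ab.1.2 = j then
        (if h : ab.1.1 < i then p.1 ⟨(ab.1.1, i), h⟩
         else if h' : i < ab.1.1 then -(p.1 ⟨(i, ab.1.1), h'⟩) else 0)
      else if ab.1.1 = j then
        (if h : i < ab.1.2 then p.1 ⟨(i, ab.1.2), h⟩ else 0)
      else 0),
    Pi.single j (p.2 i))

/-- The degree `0` generator
`Y⁰_{ii} = z^i ∂/∂z^i + Σ_{k<i} w^{ki} ∂/∂w^{ki} + Σ_{i<k} w^{ik} ∂/∂w^{ik}`. -/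
def Y0diag (n : ℕ) (i : Fin n) : soAmb n → soAmb n := fun p =>
  ((fun ab => if ab.1.1 = i ∨ ab.1.2 = i then p.1 ab else 0),
    Pi.single i (p.2 i))

/-- The degree `0` generator for `j < i`:
`Y⁰_{ij} = z^i ∂/∂z^j + Σ_{k<j} w^{ki} ∂/∂w^{kj} - Σ_{j<k<i} w^{ki} ∂/∂w^{jk}
  + Σ_{i<k} w^{ik} ∂/∂w^{jk}`. -/
def Y0gt (n : ℕ) (i j : Fin n) : soAmb n → soAmb n := fun p =>
  ((fun ab =>
      if ab.1.2 = j then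
        (if h : ab.1.1 < i then p.1 ⟨(ab.1.1, i), h⟩ else 0)
      else if ab.1.1 = j then
        (if h : ab.1.2 < i then -(p.1 ⟨(ab.1.2, i), h⟩)
         else if h' : i < ab.1.2 then p.1 ⟨(i, ab.1.2), h'⟩ else 0)
      else 0),
    Pi.single j (p.2 i))

/-- The rotation `R = i·(z^1 ∂/∂z^1 + … + z^{ℓ-1} ∂/∂z^{ℓ-1})`. -/
def Rrot (n : ℕ) : soAmb n → soAmb n := fun p =>
  ((0 : soIdx n → ℂ), fun k => Complex.I * p.2 k)

/-- The derivative of the defining function `ρ^{ij}`, as a sesquilinear expression. -/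
theorem fderiv_rho_apply (n : ℕ) (ij : soIdx n) (p v : soAmb n) :
    fderiv ℝ (rho n ij) p v =
      (v.1 ij - (p.2 ij.1.1 * conj (v.2 ij.1.2) + v.2 ij.1.1 * conj (p.2 ij.1.2))).im := by
  let W : soAmb n →L[ℝ] ℂ :=
    (ContinuousLinearMap.proj ij).comp (ContinuousLinearMap.fst ℝ (soIdx n → ℂ) (Fin n → ℂ))
  let Z (k : Fin n) : soAmb n →L[ℝ] ℂ :=
    (ContinuousLinearMap.proj k).comp (ContinuousLinearMap.snd ℝ (soIdx n → ℂ) (Fin n → ℂ))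
  let C : soAmb n →L[ℝ] ℂ := (Complex.conjCLE : ℂ →L[ℝ] ℂ).comp (Z ij.1.2)
  have h : HasFDerivAt (rho n ij) _ p :=
    Complex.imCLM.hasFDerivAt.comp p
      (W.hasFDerivAt.sub ((Z ij.1.1).hasFDerivAt.mul C.hasFDerivAt))
  rw [h.fderiv]
  simp [W, Z, C]
  ring

/-- A vector field is an infinitesimal CR symmetry as soon as it annihilates the defining
functions, the equations of the manifold being available in coordinates. -/
theorem isInfCRSym_of_im_eq_zero {n : ℕ} {V : soAmb n → soAmb n}
    (h : ∀ p : soAmb n,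
      (∀ a b (hab : a < b), (p.1 ⟨(a, b), hab⟩ - p.2 a * conj (p.2 b)).im = 0) →
      ∀ a b (hab : a < b), ((V p).1 ⟨(a, b), hab⟩ -
        (p.2 a * conj ((V p).2 b) + (V p).2 a * conj (p.2 b))).im = 0) :
    IsInfCRSym n V := by
  rintro p hp ⟨⟨a, b⟩, hab⟩
  rw [fderiv_rho_apply]
  exact h p (fun a b hab => hp ⟨(a, b), hab⟩) a b hab

theorem isInfCRSym_Yw (n : ℕ) (ij : soIdx n) : IsInfCRSym n (Yw n ij) := by
  refine isInfCRSym_of_im_eq_zero fun p _ a b hab => ?_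
  by_cases h : (⟨(a, b), hab⟩ : soIdx n) = ij <;> simp [Yw, h]

theorem isInfCRSym_Yz (n : ℕ) (i : Fin n) : IsInfCRSym n (Yz n i) := by
  refine isInfCRSym_of_im_eq_zero fun p _ a b hab => ?_
  by_cases hb : b = i
  · subst hb
    simp [Yz, hab.ne]
  · by_cases ha : a = i <;> simp [Yz, ha, hb]

theorem isInfCRSym_IYz (n : ℕ) (i : Fin n) : IsInfCRSym n (IYz n i) := by
  refine isInfCRSym_of_im_eq_zero fun p _ a b hab => ?_
  by_cases hb : b = i
  · subst hb
    simp [IYz, hab.ne]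
  · by_cases ha : a = i <;> simp [IYz, ha, hb]

theorem isInfCRSym_Y0lt (n : ℕ) {i j : Fin n} (hij : i < j) : IsInfCRSym n (Y0lt n i j) := by
  refine isInfCRSym_of_im_eq_zero fun p hp a b hab => ?_
  by_cases hb : b = j
  · subst hb
    rcases lt_trichotomy a i with h | rfl | h
    · have := hp a i h
      simp [Y0lt, hab.ne, h] at this ⊢
      linarith
    · simp [Y0lt, hab.ne]
      ring
    · have := hp i a h
      simp [Y0lt, hab.ne, h, h.not_gt] at this ⊢
      linarith
  · by_cases ha : a = j
    · subst ha
      have := hp i b (hij.trans hab)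
      simp [Y0lt, hb, hij.trans hab] at this ⊢
      linarith
    · simp [Y0lt, ha, hb]

theorem isInfCRSym_Y0diag (n : ℕ) (i : Fin n) : IsInfCRSym n (Y0diag n i) := by
  refine isInfCRSym_of_im_eq_zero fun p hp a b hab => ?_
  have := hp a b hab
  by_cases hb : b = i
  · subst hb
    simp [Y0diag, hab.ne] at this ⊢
    linarith
  · by_cases ha : a = i
    · subst ha
      simp [Y0diag, hb] at this ⊢
      linarith
    · simp [Y0diag, ha, hb]

theorem isInfCRSym_Y0gt (n : ℕ) {i j : Fin n} (hji : j < i) : IsInfCRSym n (Y0gt n i j) := by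
  refine isInfCRSym_of_im_eq_zero fun p hp a b hab => ?_
  by_cases hb : b = j
  · subst hb
    have := hp a i (hab.trans hji)
    simp [Y0gt, hab.ne, hab.trans hji] at this ⊢
    linarith
  · by_cases ha : a = j
    · subst ha
      rcases lt_trichotomy b i with h | rfl | h
      · have := hp b i h
        simp [Y0gt, hb, h] at this ⊢
        linarith
      · simp [Y0gt, hb]
        ring
      · have := hp i b h
        simp [Y0gt, hb, h, h.not_gt] at this ⊢
        linarith
    · simp [Y0gt, ha, hb]

theorem isInfCRSym_Rrot (n : ℕ) : IsInfCRSym n (Rrot n) := by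
  refine isInfCRSym_of_im_eq_zero fun p _ a b hab => ?_
  simp [Rrot]
  ring

/-- For every `ℓ ≥ 4`, all the listed holomorphic vector fields — the generators
`Y^{-2}_{w^{ij}}`, `Y^{-1}_{z^i}`, `IY^{-1}_{z^i}`, `Y⁰_{ij}` (for `i < j`, `i = j` and
`j < i`) and the rotation `R` — are infinitesimal CR symmetries of `M^{N(ℓ)}`:
the real part `Y + conj Y` of each is tangent to `M^{N(ℓ)}` at every point. -/
theorem SO_flat_model_infinitesimal_CR_symmetries :
    ∀ ℓ : ℕ, 4 ≤ ℓ →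
      (∀ ij : soIdx (ℓ - 1), IsInfCRSym (ℓ - 1) (Yw (ℓ - 1) ij)) ∧
      (∀ i : Fin (ℓ - 1), IsInfCRSym (ℓ - 1) (Yz (ℓ - 1) i)) ∧
      (∀ i : Fin (ℓ - 1), IsInfCRSym (ℓ - 1) (IYz (ℓ - 1) i)) ∧
      (∀ i j : Fin (ℓ - 1), i < j → IsInfCRSym (ℓ - 1) (Y0lt (ℓ - 1) i j)) ∧
      (∀ i : Fin (ℓ - 1), IsInfCRSym (ℓ - 1) (Y0diag (ℓ - 1) i)) ∧
      (∀ i j : Fin (ℓ - 1), j < i → IsInfCRSym (ℓ - 1) (Y0gt (ℓ - 1) i j)) ∧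
      IsInfCRSym (ℓ - 1) (Rrot (ℓ - 1)) := by
  exact fun ℓ _ => ⟨isInfCRSym_Yw _, isInfCRSym_Yz _, isInfCRSym_IYz _,
    fun _ _ => isInfCRSym_Y0lt _, isInfCRSym_Y0diag _, fun _ _ => isInfCRSym_Y0gt _,
    isInfCRSym_Rrot _⟩
end
end
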